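/- arXiv:1205.3983 — 14 statements merged into one kernel-verified Lean document; each statement's English description precedes it below -/
import Mathlib

section
/- Suppose the graphs G and H have no isolated vertices, G∗R = H, and R has full domain. Then the number of connected components of G is at least the number of connected components of H. -/
def srel {V B : Type*} (E : V → V → Prop) (R : V → B → Prop) : B → B → Prop :=
  fun u v => ∃ x y, E x y ∧ R x u ∧ R y v

/-- If `G` and `H` have no isolated vertices, `G ∗ R = H` and `R` has full domain,
then the number of connected components of `G` is at least that of `H`.
(Connected components are the classes of the reachability relation, so their number
is the cardinality of the quotient by `Relation.ReflTransGen` of the edge relation.) -/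
theorem stmt3 {V W : Type*} [Fintype V] [Fintype W]
    (E : V → V → Prop) (hE : Symmetric E)
    (F : W → W → Prop) (hF : Symmetric F)
    (R : V → W → Prop)
    (hGnoiso : ∀ x : V, ∃ y, E x y)
    (hHnoiso : ∀ u : W, ∃ v, F u v)
    (hdom : ∀ x : V, ∃ b : W, R x b)
    (himg : ∀ b : W, ∃ v : V, R v b)
    (hstar : ∀ u v : W, srel E R u v ↔ F u v) :
    Nat.card (Quot (Relation.ReflTransGen F)) ≤
      Nat.card (Quot (Relation.ReflTransGen E)) := by
  choose f hf using hdom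
  have key : ∀ x y, E x y → F (f x) (f y) := fun x y h =>
    (hstar _ _).1 ⟨x, y, h, hf x, hf y⟩
  let g : Quot (Relation.ReflTransGen E) → Quot (Relation.ReflTransGen F) :=
    Quot.map f (fun _ _ h => Relation.ReflTransGen.lift f key _ _ h)
  refine Nat.card_le_card_of_surjective g ?_
  intro q
  induction q using Quot.ind with
  | mk b =>
    obtain ⟨v, hv⟩ := himg b
    obtain ⟨y, hy⟩ := hGnoiso v
    refine ⟨Quot.mk _ v, ?_⟩
    have h1 : F (f v) (f y) := key v y hy
    have h2 : F (f y) b := hF ((hstar _ _).1 ⟨v, y, hy, hv, hf y⟩)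
    exact Quot.sound ((Relation.ReflTransGen.single h1).tail h2)
end

section
/- Let G be a simple (loopless) graph, let R have full domain, and suppose H = G∗R is also simple. Then the chromatic number of G is at most the chromatic number of H, i.e., χ(G) ≤ χ(G∗R). -/
/-- The chromatic number of a (loopless) graph: the least `n` admitting a proper
`n`-coloring. -/
noncomputable def chromNum {V : Type*} [Fintype V] (E : V → V → Prop) : ℕ :=
  sInf {n : ℕ | ∃ c : V → Fin n, ∀ x y, E x y → c x ≠ c y}

/-- If `G` is simple, `R` has full domain, and `H = G ∗ R` is simple, then
`χ(G) ≤ χ(G ∗ R)`. -/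
theorem stmt4 {V W : Type*} [Fintype V] [Fintype W]
    (E : V → V → Prop) (hE : Symmetric E) (hEloopless : ∀ x, ¬ E x x)
    (F : W → W → Prop) (hF : Symmetric F) (hFloopless : ∀ u, ¬ F u u)
    (R : V → W → Prop)
    (hdom : ∀ x : V, ∃ b : W, R x b)
    (himg : ∀ b : W, ∃ v : V, R v b)
    (hstar : ∀ u v : W, srel E R u v ↔ F u v) :
    chromNum E ≤ chromNum F := by
  choose f hf using hdom
  have hne : {n : ℕ | ∃ c : W → Fin n, ∀ x y, F x y → c x ≠ c y}.Nonempty := by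
    refine ⟨Fintype.card W, Fintype.equivFin W, fun x y hxy h => ?_⟩
    have h' := (Fintype.equivFin W).injective h
    subst h'
    exact hFloopless _ hxy
  obtain ⟨c, hc⟩ := Nat.sInf_mem hne
  exact Nat.sInf_le ⟨fun x => c (f x), fun x y hxy =>
    hc _ _ ((hstar _ _).1 ⟨x, y, hxy, hf x, hf y⟩)⟩
end

section
/- Suppose G∗R = H where R has full domain, and let x,y ∈ V_G, u,v ∈ V_H satisfy (x,u) ∈ R and (y,v) ∈ R. If x ≠ y, then d_H(u,v) ≤ d_G(x,y). If x = y and x is not an isolated vertex of G, then d_H(u,v) ≤ 2. -/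
/-- `wdist E x y ∈ ℕ ∪ {∞}` is the least number of edges of a walk from `x` to `y`
(`∞` if there is none). -/
noncomputable def wdist {V : Type*} (E : V → V → Prop) (x y : V) : ℕ∞ :=
  sInf {n : ℕ∞ | ∃ m : ℕ, (m : ℕ∞) = n ∧
    ∃ f : ℕ → V, f 0 = x ∧ f m = y ∧ ∀ i < m, E (f i) (f (i + 1))}

/-- Suppose `G ∗ R = H` with `R` of full domain, `(x,u) ∈ R` and `(y,v) ∈ R`.
If `x ≠ y` then `d_H(u,v) ≤ d_G(x,y)`; if `x = y` and `x` is not isolated then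
`d_H(u,v) ≤ 2`. -/
theorem stmt5 {V W : Type*} [Fintype V] [Fintype W]
    (E : V → V → Prop) (hE : Symmetric E)
    (F : W → W → Prop) (hF : Symmetric F)
    (R : V → W → Prop)
    (hdom : ∀ x : V, ∃ b : W, R x b)
    (himg : ∀ b : W, ∃ v : V, R v b)
    (hstar : ∀ u v : W, srel E R u v ↔ F u v)
    (x y : V) (u v : W) (hxu : R x u) (hyv : R y v) :
    (x ≠ y → wdist F u v ≤ wdist E x y) ∧
    (x = y → (∃ z, E x z) → wdist F u v ≤ 2) := by
  constructor
  · intro hne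
    refine le_sInf ?_
    rintro n ⟨m, rfl, f, h0, hm, hf⟩
    have hm0 : m ≠ 0 := by
      rintro rfl
      exact hne (h0.symm.trans hm)
    choose c hc using hdom
    refine sInf_le ⟨m, rfl, fun i => if i = 0 then u else if i = m then v else c (f i), ?_, ?_, ?_⟩
    · simp
    · simp [hm0]
    · have key : ∀ i, R (f i) (if i = 0 then u else if i = m then v else c (f i)) := by
        intro i
        split_ifs with h1 h2
        · rw [h1, h0]; exact hxu
        · rw [h2, hm]; exact hyv
        · exact hc _
      intro i hi
      exact (hstar _ _).1 ⟨f i, f (i + 1), hf i hi, key i, key (i + 1)⟩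
  · rintro rfl ⟨z, hz⟩
    obtain ⟨b, hb⟩ := hdom z
    refine sInf_le ⟨2, rfl, fun i => if i = 0 then u else if i = 1 then b else v, ?_, ?_, ?_⟩
    · simp
    · simp
    · intro i hi
      have h1 : F u b := (hstar _ _).1 ⟨x, z, hz, hxu, hb⟩
      have h2 : F b v := (hstar _ _).1 ⟨z, x, hE hz, hb, hyv⟩
      interval_cases i
      · simpa using h1
      · simpa using h2
end

section
/- Suppose G∗R = H, where G and H are connected graphs and R has full domain. Then rad(H) ≤ max{rad(G), 2}. -/
/-- The radius of a graph: the minimum over vertices `v` of the eccentricity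
`⨆ u, wdist E v u`. -/
noncomputable def grad {V : Type*} (E : V → V → Prop) : ℕ∞ :=
  ⨅ v, ⨆ u, wdist E v u

theorem wdist_le_of_walk {V : Type*} (E : V → V → Prop) (x y : V) (m : ℕ) (f : ℕ → V)
    (h0 : f 0 = x) (hm : f m = y) (h : ∀ i < m, E (f i) (f (i + 1))) :
    wdist E x y ≤ m :=
  sInf_le ⟨m, rfl, f, h0, hm, h⟩

/-- If `G ∗ R = H` with `G`, `H` connected and `R` of full domain, then
`rad(H) ≤ max (rad G) 2`. -/
theorem stmt6 {V W : Type*} [Fintype V] [Fintype W] [Nonempty W]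
    (E : V → V → Prop) (hE : Symmetric E)
    (F : W → W → Prop) (hF : Symmetric F)
    (hGconn : ∀ x y : V, Relation.ReflTransGen E x y)
    (hHconn : ∀ u v : W, Relation.ReflTransGen F u v)
    (R : V → W → Prop)
    (hdom : ∀ x : V, ∃ b : W, R x b)
    (himg : ∀ b : W, ∃ v : V, R v b)
    (hstar : ∀ u v : W, srel E R u v ↔ F u v) :
    grad F ≤ max (grad E) 2 := by
  classical
  obtain ⟨b0⟩ := ‹Nonempty W›
  obtain ⟨v0, _⟩ := himg b0
  haveI : Nonempty V := ⟨v0⟩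
  obtain ⟨c, hc⟩ : ∃ c, (⨆ u, wdist E c u) = grad E :=
    ciInf_mem (fun v => ⨆ u, wdist E v u)
  obtain ⟨b, hb⟩ := hdom c
  refine (iInf_le _ b).trans (iSup_le fun u => ?_)
  obtain ⟨v, hv⟩ := himg u
  have hcv : wdist E c v ≤ grad E := hc ▸ le_iSup (fun u => wdist E c u) v
  refine le_trans ?_ (max_le_max_right 2 hcv)
  rcases Set.eq_empty_or_nonempty {n : ℕ∞ | ∃ m : ℕ, (m : ℕ∞) = n ∧
    ∃ f : ℕ → V, f 0 = c ∧ f m = v ∧ ∀ i < m, E (f i) (f (i + 1))} with he | hne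
  · have : wdist E c v = ⊤ := by unfold wdist; rw [he, sInf_empty]
    rw [this]; simp
  · obtain ⟨m, hm, f, h0, hfm, hf⟩ := csInf_mem hne
    change (m : ℕ∞) = wdist E c v at hm
    rw [← hm]
    choose g hg using hdom
    rcases Nat.eq_zero_or_pos m with rfl | hpos
    · have hvc : v = c := by rw [← hfm, h0]
      subst hvc
      refine le_trans ?_ (le_max_right _ _)
      by_cases hn : ∃ w, E v w
      · obtain ⟨w, hw⟩ := hn
        refine wdist_le_of_walk F b u 2
          (fun i => if i = 0 then b else if i = 1 then g w else u) (by simp) (by simp) ?_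
        intro i hi
        have h1 : F b (g w) := (hstar _ _).1 ⟨v, w, hw, hb, hg w⟩
        have h2 : F (g w) u := (hstar _ _).1 ⟨w, v, hE hw, hg w, hv⟩
        interval_cases i <;> simp [h1, h2]
      · have hall : ∀ x, x = v := by
          intro x
          rcases Relation.ReflTransGen.cases_head (hGconn v x) with h | ⟨w, hw, _⟩
          · exact h.symm
          · exact absurd ⟨w, hw⟩ hn
        have hbu : b = u := by
          rcases Relation.ReflTransGen.cases_head (hHconn b u) with h | ⟨w, hw, _⟩
          · exact h
          · obtain ⟨x, y, hxy, _⟩ := (hstar _ _).2 hw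
            exact absurd ⟨y, hall x ▸ hxy⟩ hn
        exact (wdist_le_of_walk F b u 0 (fun _ => b) rfl hbu (by simp)).trans (by simp)
    · refine le_trans ?_ (le_max_left _ _)
      have key : ∀ i, R (f i) (if i = 0 then b else if i = m then u else g (f i)) := by
        intro i
        split_ifs with h1 h2
        · rw [h1, h0]; exact hb
        · rw [h2, hfm]; exact hv
        · exact hg _
      refine wdist_le_of_walk F b u m
        (fun i => if i = 0 then b else if i = m then u else g (f i)) (by simp)
        (by simp [hpos.ne']) ?_
      intro i hi
      exact (hstar _ _).1 ⟨f i, f (i + 1), hf i hi, key i, key (i + 1)⟩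
end

section
/- For paths P_k and P_l, there exists a relation R ⊆ V_{P_k}×V_{P_l} (with image all of V_{P_l}) such that P_k∗R = P_l if and only if k ≥ l, or k = 1 and l = 2. -/
/-- The edge relation of the path `P_k` of length `k`, on vertices `0,1,…,k`:
consecutive integers are adjacent. -/
def pathRel (k : ℕ) : Fin (k + 1) → Fin (k + 1) → Prop :=
  fun i j => (i : ℕ) + 1 = (j : ℕ) ∨ (j : ℕ) + 1 = (i : ℕ)

section aux
variable (Q : ℕ → ℕ → Prop)

/-- The edge `{i,i+1}` is covered by the edge `{x,x+1}`. -/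
def Cov (x i : ℕ) : Prop := (Q x i ∧ Q (x+1) (i+1)) ∨ (Q x (i+1) ∧ Q (x+1) i)

open Classical in
noncomputable def CovS (l x : ℕ) : Finset ℕ := (Finset.range l).filter (Cov Q x)

variable {Q}

lemma cov_diam (H : ∀ x u v, Q x u → Q (x+1) v → u + 1 = v ∨ v + 1 = u) (x i j : ℕ)
    (hi : Cov Q x i ∨ Cov Q (x+1) i) (hj : Cov Q x j ∨ Cov Q (x+1) j) : j ≤ i + 1 := by
  have key : ∀ u v, (Q x u ∨ Q (x+1+1) u) → Q (x+1) v → (u + 1 = v ∨ v + 1 = u) := by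
    intro u v h h'
    rcases h with h | h
    · exact H _ _ _ h h'
    · exact (H _ _ _ h' h).symm
  have norm : ∀ i, (Cov Q x i ∨ Cov Q (x+1) i) → ∃ u v, (Q x u ∨ Q (x+1+1) u) ∧ Q (x+1) v ∧
      ((u = i ∧ v = i + 1) ∨ (u = i + 1 ∧ v = i)) := by
    intro i h
    rcases h with (⟨h, h'⟩ | ⟨h, h'⟩) | (⟨h, h'⟩ | ⟨h, h'⟩)
    · exact ⟨_, _, Or.inl h, h', by omega⟩
    · exact ⟨_, _, Or.inl h, h', by omega⟩
    · exact ⟨_, _, Or.inr h', h, by omega⟩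
    · exact ⟨_, _, Or.inr h', h, by omega⟩
  obtain ⟨u, v, h1, h2, h3⟩ := norm i hi
  obtain ⟨u', v', h1', h2', h3'⟩ := norm j hj
  have a := key u v' h1 h2'
  have b := key u' v h1' h2
  omega

lemma mem_CovS {l x i : ℕ} : i ∈ CovS Q l x ↔ i < l ∧ Cov Q x i := by
  simp [CovS]

lemma card_two (H : ∀ x u v, Q x u → Q (x+1) v → u + 1 = v ∨ v + 1 = u) (l x : ℕ) :
    (CovS Q l x ∪ CovS Q l (x+1)).card ≤ 2 := by
  by_cases hne : (CovS Q l x ∪ CovS Q l (x+1)).Nonempty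
  · set m := (CovS Q l x ∪ CovS Q l (x+1)).min' hne with hm
    have hmm : m ∈ CovS Q l x ∪ CovS Q l (x+1) := Finset.min'_mem _ _
    have : CovS Q l x ∪ CovS Q l (x+1) ⊆ Finset.Icc m (m+1) := by
      intro j hj
      have h1 : m ≤ j := Finset.min'_le _ _ hj
      simp only [Finset.mem_union, mem_CovS] at hj hmm
      rw [Finset.mem_Icc]
      exact ⟨h1, cov_diam H x m j (by tauto) (by tauto)⟩
    have := Finset.card_le_card this
    simp at this
    omega
  · rw [Finset.not_nonempty_iff_eq_empty] at hne
    simp [hne]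

lemma card_three (H : ∀ x u v, Q x u → Q (x+1) v → u + 1 = v ∨ v + 1 = u)
    (l : ℕ) (hl : ∀ x u, Q x u → u ≤ l) (x : ℕ) :
    (CovS Q l x ∪ CovS Q l (x+1) ∪ CovS Q l (x+2)).card ≤ 3 := by
  by_cases hne : ∃ c, Cov Q (x+1) c
  · obtain ⟨c, hc⟩ := hne
    have : CovS Q l x ∪ CovS Q l (x+1) ∪ CovS Q l (x+2) ⊆ Finset.Icc (c-1) (c+1) := by
      intro j hj
      simp only [Finset.mem_union, mem_CovS] at hj
      rw [Finset.mem_Icc]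
      rcases hj with (hj | hj) | hj
      · have := cov_diam H x c j (by tauto) (by tauto)
        have := cov_diam H x j c (by tauto) (by tauto)
        omega
      · have := cov_diam H x c j (by tauto) (by tauto)
        have := cov_diam H x j c (by tauto) (by tauto)
        omega
      · have := cov_diam H (x+1) c j (by tauto) (by tauto)
        have := cov_diam H (x+1) j c (by tauto) (by tauto)
        omega
    have := Finset.card_le_card this
    rw [Nat.card_Icc] at this
    omega
  · have h2 : CovS Q l (x+1) = ∅ := by
      ext c
      simp only [mem_CovS, Finset.notMem_empty, iff_false]
      exact fun h => hne ⟨c, h.2⟩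
    have h13 : CovS Q l x = ∅ ∨ CovS Q l (x+2) = ∅ := by
      by_contra hcon
      push Not at hcon
      obtain ⟨⟨a, ha⟩, ⟨b, hb⟩⟩ := hcon
      rw [mem_CovS] at ha hb
      have hu : ∃ u, Q (x+1) u := by
        rcases ha.2 with h | h
        · exact ⟨_, h.2⟩
        · exact ⟨_, h.2⟩
      have hv : ∃ v, Q (x+1+1) v := by
        rcases hb.2 with h | h
        · exact ⟨_, h.1⟩
        · exact ⟨_, h.1⟩
      obtain ⟨u, hu⟩ := hu
      obtain ⟨v, hv⟩ := hv
      rcases H _ _ _ hu hv with h | h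
      · subst h; exact hne ⟨u, Or.inl ⟨hu, hv⟩⟩
      · subst h; exact hne ⟨v, Or.inr ⟨hu, hv⟩⟩
    have t1 := card_two H l x
    have t2 : (CovS Q l (x+1) ∪ CovS Q l (x+2)).card ≤ 2 := card_two H l (x+1)
    rcases h13 with h | h
    · simp [h, h2] at t2 ⊢
      omega
    · simp [h, h2] at t1 ⊢
      omega

lemma card_all (H : ∀ x u v, Q x u → Q (x+1) v → u + 1 = v ∨ v + 1 = u)
    (l : ℕ) (hl : ∀ x u, Q x u → u ≤ l) : ∀ n,
    ((Finset.range (n+2)).biUnion (CovS Q l)).card ≤ n + 2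
  | 0 => by
    have := card_two H l 0
    simpa [Finset.range_add_one, Finset.union_comm] using this
  | 1 => by
    have := card_three H l hl 0
    simpa [Finset.range_add_one, Finset.union_comm, Finset.union_left_comm] using this
  | n+2 => by
    have ih := card_all H l hl n
    have h2 := card_two H l (n+2)
    have e : (Finset.range (n+2+2)).biUnion (CovS Q l) =
        (Finset.range (n+2)).biUnion (CovS Q l) ∪ (CovS Q l (n+2) ∪ CovS Q l (n+2+1)) := by
      rw [Finset.range_add_one, Finset.biUnion_insert, Finset.range_add_one,
        Finset.biUnion_insert]
      ext; simp only [Finset.mem_union]; tauto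
    rw [e]
    have := Finset.card_union_le ((Finset.range (n+2)).biUnion (CovS Q l))
      (CovS Q l (n+2) ∪ CovS Q l (n+2+1))
    omega

end aux

/-- There is a relation `R` (with image all of `V_{P_l}`) with `P_k ∗ R = P_l`
iff `k ≥ l`, or `k = 1` and `l = 2`. -/
theorem stmt7 (k l : ℕ) :
    (∃ R : Fin (k + 1) → Fin (l + 1) → Prop,
        (∀ b, ∃ a, R a b) ∧
        (∀ u v, srel (pathRel k) R u v ↔ pathRel l u v)) ↔
      (l ≤ k ∨ (k = 1 ∧ l = 2)) := by
  constructor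
  · rintro ⟨R, -, hE⟩
    let Q : ℕ → ℕ → Prop := fun a b => ∃ (ha : a < k + 1) (hb : b < l + 1), R ⟨a, ha⟩ ⟨b, hb⟩
    have H : ∀ x u v, Q x u → Q (x+1) v → u + 1 = v ∨ v + 1 = u := by
      rintro x u v ⟨ha, hb, h⟩ ⟨ha', hb', h'⟩
      exact (hE ⟨u, hb⟩ ⟨v, hb'⟩).1 ⟨_, _, Or.inl rfl, h, h'⟩
    have hl : ∀ x u, Q x u → u ≤ l := by
      rintro x u ⟨_, hb, _⟩
      omega
    have hcov : Finset.range l ⊆ (Finset.range k).biUnion (CovS Q l) := by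
      intro i hi
      rw [Finset.mem_range] at hi
      obtain ⟨⟨x, hx⟩, ⟨y, hy⟩, e, h, h'⟩ :=
        (hE ⟨i, by omega⟩ ⟨i+1, by omega⟩).2 (Or.inl rfl)
      simp only [Finset.mem_biUnion, Finset.mem_range, mem_CovS]
      rcases e with e | e
      · simp only at e
        subst e
        exact ⟨x, by omega, hi, Or.inl ⟨⟨hx, _, h⟩, ⟨hy, _, h'⟩⟩⟩
      · simp only at e
        subst e
        exact ⟨y, by omega, hi, Or.inr ⟨⟨hy, _, h'⟩, ⟨hx, _, h⟩⟩⟩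
    have hc := Finset.card_le_card hcov
    rw [Finset.card_range] at hc
    match k, hc with
    | 0, hc => simp at hc; omega
    | 1, hc =>
      have h2 := card_two H l 0
      have h3 := Finset.card_le_card
        (Finset.subset_union_left (s₁ := CovS Q l 0) (s₂ := CovS Q l (0+1)))
      simp at hc
      omega
    | n+2, hc =>
      have := card_all H l hl n
      omega
  · rintro (h | ⟨rfl, rfl⟩)
    · refine ⟨fun a b => a.val = b.val, fun b => ⟨⟨b, by omega⟩, rfl⟩, fun u v => ⟨?_, ?_⟩⟩
      · rintro ⟨x, y, e, hx, hy⟩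
        simp only [pathRel] at *
        omega
      · intro e
        exact ⟨⟨u, by omega⟩, ⟨v, by omega⟩, e, rfl, rfl⟩
    · refine ⟨fun a b => a.val = b.val % 2, fun b => ⟨⟨b % 2, by omega⟩, rfl⟩,
        fun u v => ⟨?_, ?_⟩⟩
      · rintro ⟨x, y, e, hx, hy⟩
        simp only [pathRel] at *
        omega
      · intro e
        refine ⟨⟨u % 2, by omega⟩, ⟨v % 2, by omega⟩, ?_, rfl, rfl⟩
        simp only [pathRel] at *
        omega
end

section
/- Let H be a simple (loopless) graph and K_k the complete loopless graph on k vertices. Then there exists a relation R ⊆ V_{K_k}×V_H (with image all of V_H) such that K_k∗R = H if and only if every connected component of the complement graph H̄ is a complete graph and H̄ has at most k connected components. -/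
/-- Let `H` be a simple graph (edge relation `F` on `W`).  There is a relation
`R ⊆ V_{K_k} × W` (image all of `W`) with `K_k ∗ R = H` iff every connected
component of the complement `H̄` is complete and `H̄` has at most `k` components.
The complement's edge relation is `fun u v => u ≠ v ∧ ¬ F u v`; its components are
the classes of the reachability relation. -/
theorem stmt8 {W : Type*} [Fintype W] (k : ℕ)
    (F : W → W → Prop) (hF : Symmetric F) (hFloopless : ∀ u, ¬ F u u) :
    (∃ R : Fin k → W → Prop,
        (∀ b : W, ∃ a, R a b) ∧
        (∀ u v : W, srel (fun i j : Fin k => i ≠ j) R u v ↔ F u v)) ↔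
      ((∀ u v : W, u ≠ v →
          Relation.ReflTransGen (fun a b => a ≠ b ∧ ¬ F a b) u v →
          (u ≠ v ∧ ¬ F u v)) ∧
        Nat.card (Quot (Relation.ReflTransGen (fun a b : W => a ≠ b ∧ ¬ F a b))) ≤ k) := by
  constructor
  · rintro ⟨R, hR, h⟩
    choose f hf using hR
    have huniq : ∀ x u, R x u → x = f u := by
      intro x u hx
      by_contra hne
      exact hFloopless u ((h u u).1 ⟨x, f u, hne, hx, hf u⟩)
    have key : ∀ u v, F u v ↔ f u ≠ f v := by
      intro u v
      rw [← h u v]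
      constructor
      · rintro ⟨x, y, hxy, hx, hy⟩
        rw [← huniq x u hx, ← huniq y v hy]
        exact hxy
      · intro hne
        exact ⟨f u, f v, hne, hf u, hf v⟩
    have reach : ∀ u v, Relation.ReflTransGen (fun a b => a ≠ b ∧ ¬ F a b) u v → f u = f v := by
      intro u v huv
      induction huv with
      | refl => rfl
      | tail _ hbc ih =>
        have h2 := hbc.2
        rw [key, not_not] at h2
        exact ih.trans h2
    refine ⟨fun u v huv hr => ⟨huv, ?_⟩, ?_⟩
    · rw [key, not_not]
      exact reach u v hr
    · have hinj : Function.Injective (Quot.lift f reach) := by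
        intro a b
        induction a using Quot.ind with | mk a
        induction b using Quot.ind with | mk b
        intro hab
        have hab' : f a = f b := hab
        by_cases hne : a = b
        · rw [hne]
        · exact Quot.sound (Relation.ReflTransGen.single ⟨hne, by rw [key, not_not]; exact hab'⟩)
      have := Nat.card_le_card_of_injective _ hinj
      simpa using this
  · rintro ⟨hc, hk⟩
    have hsymm : ∀ a b, Relation.ReflTransGen (fun a b => a ≠ b ∧ ¬ F a b) a b →
        Relation.ReflTransGen (fun a b => a ≠ b ∧ ¬ F a b) b a := by
      intro a b hab
      by_cases hne : a = b
      · rw [hne]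
      · exact Relation.ReflTransGen.single ⟨Ne.symm hne, fun hba => (hc a b hne hab).2 (hF hba)⟩
    have heq : Equivalence (Relation.ReflTransGen (fun a b : W => a ≠ b ∧ ¬ F a b)) :=
      ⟨fun _ => Relation.ReflTransGen.refl, fun {a b} => hsymm a b, fun h1 h2 => h1.trans h2⟩
    have hfin : Finite (Quot (Relation.ReflTransGen (fun a b : W => a ≠ b ∧ ¬ F a b))) :=
      Finite.of_surjective (Quot.mk _) Quot.mk_surjective
    let e := (Finite.equivFin (Quot (Relation.ReflTransGen (fun a b : W => a ≠ b ∧ ¬ F a b))))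
    refine ⟨fun a b => Fin.castLE hk (e (Quot.mk _ b)) = a, fun b => ⟨_, rfl⟩, fun u v => ?_⟩
    constructor
    · rintro ⟨x, y, hxy, rfl, rfl⟩
      by_contra hF'
      apply hxy
      by_cases hne : u = v
      · rw [hne]
      · rw [Quot.sound (Relation.ReflTransGen.single ⟨hne, hF'⟩)]
    · intro huv
      refine ⟨_, _, fun hxy => ?_, rfl, rfl⟩
      have h1 := e.injective (Fin.castLE_injective hk hxy)
      have h2 := (heq.quot_mk_eq_iff u v).1 h1
      have hne : u ≠ v := by
        rintro rfl
        exact hFloopless u huv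
      exact (hc u v hne h2).2 huv
end

section
/- Suppose G∗R = H, and let S ⊆ V_G and D ⊆ V_H be such that G[S] ∗ (R ∩ (S×D)) = H[D], the relation R ∩ (S×D) has full domain on S, and the graph D̄ has no isolated vertex, where D̄ is the subgraph of H induced on V_H ∖ ⋃_{u∈D} N_H[u] and S̄ is the subgraph of G induced on V_G ∖ ⋃_{x∈S} N_G[x]. Then S̄ ∗ R̃ = D̄, where R̃ is the restriction of R to V_{S̄}×V_{D̄}. -/
/-- Suppose `G ∗ R = H`, `S ⊆ V_G`, `D ⊆ V_H` with `G[S] ∗ (R ∩ (S×D)) = H[D]`,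
`R ∩ (S×D)` of full domain on `S`, and the graph `D̄` (induced on the vertices of
`H` outside all closed neighborhoods of `D`) has no isolated vertex.  Then
`S̄ ∗ R̃ = D̄`, where `S̄` is defined analogously in `G` and `R̃` is the restriction
of `R` to `V_{S̄} × V_{D̄}`. -/
theorem stmt9 {V W : Type*} [Fintype V] [Fintype W]
    (E : V → V → Prop) (hE : Symmetric E)
    (F : W → W → Prop) (hF : Symmetric F)
    (R : V → W → Prop)
    (himg : ∀ b : W, ∃ v : V, R v b)
    (hstar : ∀ u v : W, srel E R u v ↔ F u v)
    (S : Set V) (D : Set W)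
    -- vertex sets of S̄ and D̄: complements of the union of closed neighborhoods
    (Sbar : Set V) (hSbar : Sbar = {x : V | ∀ s ∈ S, x ≠ s ∧ ¬ E s x})
    (Dbar : Set W) (hDbar : Dbar = {u : W | ∀ d ∈ D, u ≠ d ∧ ¬ F d u})
    -- G[S] ∗ (R ∩ (S×D)) = H[D] : edges …
    (hSD : ∀ u v : W,
        srel (fun x y => E x y ∧ x ∈ S ∧ y ∈ S)
          (fun x b => R x b ∧ x ∈ S ∧ b ∈ D) u v ↔ (F u v ∧ u ∈ D ∧ v ∈ D))
    -- … and vertices (the image of R ∩ (S×D) is all of D)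
    (hSDimg : ∀ b ∈ D, ∃ x ∈ S, R x b)
    -- R ∩ (S×D) has full domain on S
    (hSDdom : ∀ x ∈ S, ∃ b ∈ D, R x b)
    -- D̄ has no isolated vertex
    (hDbarnoiso : ∀ u ∈ Dbar, ∃ v ∈ Dbar, F u v) :
    -- conclusion: S̄ ∗ R̃ = D̄, both on edges …
    (∀ u v : W,
        srel (fun x y => E x y ∧ x ∈ Sbar ∧ y ∈ Sbar)
          (fun x b => R x b ∧ x ∈ Sbar ∧ b ∈ Dbar) u v ↔
          (F u v ∧ u ∈ Dbar ∧ v ∈ Dbar)) ∧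
    -- … and on vertices (the image of R̃ is all of V_{D̄})
    (∀ b ∈ Dbar, ∃ x ∈ Sbar, R x b) := by
  subst hSbar hDbar
  have key : ∀ x y u v, E x y → R x u → R y v →
      u ∈ {u : W | ∀ d ∈ D, u ≠ d ∧ ¬ F d u} → v ∈ {u : W | ∀ d ∈ D, u ≠ d ∧ ¬ F d u} →
      x ∈ {x : V | ∀ s ∈ S, x ≠ s ∧ ¬ E s x} := by
    intro x y u v hxy hxu hyv hu hv s hs
    obtain ⟨b, hb, hsb⟩ := hSDdom s hs
    constructor
    · rintro rfl
      exact (hv b hb).2 ((hstar b v).1 ⟨x, y, hxy, hsb, hyv⟩)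
    · intro hsx
      exact (hu b hb).2 ((hstar b u).1 ⟨s, x, hsx, hsb, hxu⟩)
  refine ⟨fun u v => ⟨?_, ?_⟩, ?_⟩
  · rintro ⟨x, y, ⟨hxy, _, _⟩, ⟨hxu, _, hu⟩, ⟨hyv, _, hv⟩⟩
    exact ⟨(hstar u v).1 ⟨x, y, hxy, hxu, hyv⟩, hu, hv⟩
  · rintro ⟨huv, hu, hv⟩
    obtain ⟨x, y, hxy, hxu, hyv⟩ := (hstar u v).2 huv
    have hx := key x y u v hxy hxu hyv hu hv
    have hy := key y x v u (hE hxy) hyv hxu hv hu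
    exact ⟨x, y, ⟨hxy, hx, hy⟩, ⟨hxu, hx, hu⟩, ⟨hyv, hy, hv⟩⟩
  · intro b hb
    obtain ⟨v, hv, hbv⟩ := hDbarnoiso b hb
    obtain ⟨x, y, hxy, hxu, hyv⟩ := (hstar b v).2 hbv
    exact ⟨x, key x y b v hxy hxu hyv hb hv, hxu⟩
end

section
/- Let R ⊆ V_G×B have full domain and image all of B. Then R is reversible with respect to G, i.e., (G∗R)∗R⁺ = G, if and only if for every two vertices x,y ∈ V_G with R(x) ∩ R(y) ≠ ∅ one has N_G(x) = N_G(y). -/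
/-- A relation `R ⊆ V_G × B` with full domain and full image is reversible with
respect to `G` (i.e. `(G ∗ R) ∗ R⁺ = G`) iff any two vertices whose images under
`R` intersect have the same open neighborhood. -/
theorem stmt10 {V B : Type*} [Fintype V] [Fintype B]
    (E : V → V → Prop) (hE : Symmetric E)
    (R : V → B → Prop)
    (hdom : ∀ x : V, ∃ b : B, R x b)
    (himg : ∀ b : B, ∃ v : V, R v b) :
    (∀ x y : V, srel (srel E R) (fun b z => R z b) x y ↔ E x y) ↔
      (∀ x y : V, (∃ b, R x b ∧ R y b) → ∀ z, E x z ↔ E y z) := by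
  constructor
  · intro h x y hxy z
    obtain ⟨b, hx, hy⟩ := hxy
    obtain ⟨c, hc⟩ := hdom z
    constructor
    · intro e
      exact (h y z).1 ⟨b, c, ⟨x, z, e, hx, hc⟩, hy, hc⟩
    · intro e
      exact (h x z).1 ⟨b, c, ⟨y, z, e, hy, hc⟩, hx, hc⟩
  · intro h x y
    constructor
    · rintro ⟨u, v, ⟨p, q, e, hp, hq⟩, hx, hy⟩
      have e1 : E x q := (h p x ⟨u, hp, hx⟩ q).1 e
      exact hE ((h q y ⟨v, hq, hy⟩ x).1 (hE e1))
    · intro e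
      obtain ⟨b, hb⟩ := hdom x
      obtain ⟨c, hc⟩ := hdom y
      exact ⟨b, c, ⟨x, y, e, hb, hc⟩, hb, hc⟩
end

section
/- Two graphs G and H are strongly relationally equivalent if and only if their thin graphs G_thin and H_thin are isomorphic. -/
/-- The thinness relation: two vertices are equivalent iff they have the same open
neighborhood. -/
def thinSetoid {V : Type*} (E : V → V → Prop) : Setoid V :=
  ⟨fun x y => ∀ z, E x z ↔ E y z,
    fun _ _ => Iff.rfl, fun h z => (h z).symm, fun h h' z => (h z).trans (h' z)⟩

/-- Adjacency in the thin graph `G/S`: two classes are adjacent iff some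
representatives are adjacent in `G`. -/
def thinAdj {V : Type*} (E : V → V → Prop) :
    Quotient (thinSetoid E) → Quotient (thinSetoid E) → Prop :=
  fun σ τ => ∃ x y, Quotient.mk (thinSetoid E) x = σ ∧
    Quotient.mk (thinSetoid E) y = τ ∧ E x y

theorem thinAdj_mk {V : Type*} (E : V → V → Prop) (hE : Symmetric E) (x y : V) :
    thinAdj E (Quotient.mk (thinSetoid E) x) (Quotient.mk (thinSetoid E) y) ↔ E x y := by
  constructor
  · rintro ⟨a, b, ha, hb, hab⟩
    have h1 : ∀ z, E a z ↔ E x z := Quotient.exact ha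
    have h2 : ∀ z, E b z ↔ E y z := Quotient.exact hb
    exact hE ((h2 x).1 (hE ((h1 b).1 hab)))
  · intro h
    exact ⟨x, y, rfl, rfl, h⟩

/-- `G` and `H` are strongly relationally equivalent (there is `R` with full domain
and image with `G ∗ R = H` and `H ∗ R⁺ = G`) iff their thin graphs are isomorphic. -/
theorem stmt11 {V W : Type*} [Fintype V] [Fintype W]
    (E : V → V → Prop) (hE : Symmetric E)
    (F : W → W → Prop) (hF : Symmetric F) :
    (∃ R : V → W → Prop,
        (∀ x : V, ∃ b : W, R x b) ∧ (∀ b : W, ∃ x : V, R x b) ∧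
        (∀ u v : W, srel E R u v ↔ F u v) ∧
        (∀ x y : V, srel F (fun b z => R z b) x y ↔ E x y)) ↔
      (∃ φ : Quotient (thinSetoid E) ≃ Quotient (thinSetoid F),
        ∀ σ τ, thinAdj E σ τ ↔ thinAdj F (φ σ) (φ τ)) := by
  constructor
  · rintro ⟨R, hd, hi, h1, h2⟩
    have key : ∀ x y u v, R x u → R y v → (E x y ↔ F u v) := fun x y u v hx hy =>
      ⟨fun h => (h1 u v).1 ⟨x, y, h, hx, hy⟩, fun h => (h2 x y).1 ⟨u, v, h, hx, hy⟩⟩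
    choose f hf using hd
    choose g hg using hi
    refine ⟨⟨Quotient.map' (s₁ := thinSetoid E) (s₂ := thinSetoid F) f ?_,
      Quotient.map' (s₁ := thinSetoid F) (s₂ := thinSetoid E) g ?_, ?_, ?_⟩, ?_⟩
    · intro x x' (h : ∀ z, E x z ↔ E x' z) w
      exact ((key _ _ _ _ (hf x) (hg w)).symm.trans (h _)).trans (key _ _ _ _ (hf x') (hg w))
    · intro x x' (h : ∀ z, F x z ↔ F x' z) w
      exact ((key _ _ _ _ (hg x) (hf w)).trans (h _)).trans (key _ _ _ _ (hg x') (hf w)).symm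
    · intro q
      induction q using Quotient.inductionOn with
      | _ x =>
        refine Quotient.sound (s := thinSetoid E) (fun z => ?_)
        exact (key _ _ _ _ (hg (f x)) (hf z)).trans (key _ _ _ _ (hf x) (hf z)).symm
    · intro q
      induction q using Quotient.inductionOn with
      | _ u =>
        refine Quotient.sound (s := thinSetoid F) (fun z => ?_)
        exact (key _ _ _ _ (hf (g u)) (hg z)).symm.trans (key _ _ _ _ (hg u) (hg z))
    · intro σ τ
      induction σ using Quotient.inductionOn with
      | _ x =>
        induction τ using Quotient.inductionOn with
        | _ y =>
          refine (thinAdj_mk E hE x y).trans ?_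
          exact (key _ _ _ _ (hf x) (hf y)).trans (thinAdj_mk F hF (f x) (f y)).symm
  · rintro ⟨φ, hφ⟩
    have key : ∀ x y u v, φ (Quotient.mk _ x) = Quotient.mk _ u →
        φ (Quotient.mk _ y) = Quotient.mk _ v → (E x y ↔ F u v) := by
      intro x y u v hx hy
      rw [← thinAdj_mk E hE, ← thinAdj_mk F hF, ← hx, ← hy]
      exact hφ _ _
    have hd : ∀ x : V, ∃ b : W, φ (Quotient.mk _ x) = Quotient.mk _ b := fun x => by
      obtain ⟨b, hb⟩ := Quotient.exists_rep (φ (Quotient.mk _ x))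
      exact ⟨b, hb.symm⟩
    have hi : ∀ b : W, ∃ x : V, φ (Quotient.mk _ x) = Quotient.mk _ b := fun b => by
      obtain ⟨x, hx⟩ := Quotient.exists_rep (φ.symm (Quotient.mk _ b))
      exact ⟨x, by rw [hx]; simp⟩
    refine ⟨fun x u => φ (Quotient.mk _ x) = Quotient.mk _ u, hd, hi, ?_, ?_⟩
    · intro u v
      constructor
      · rintro ⟨x, y, h, hx, hy⟩
        exact (key _ _ _ _ hx hy).1 h
      · intro h
        obtain ⟨x, hx⟩ := hi u
        obtain ⟨y, hy⟩ := hi v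
        exact ⟨x, y, (key _ _ _ _ hx hy).2 h, hx, hy⟩
    · intro x y
      constructor
      · rintro ⟨u, v, h, hx, hy⟩
        exact (key _ _ _ _ hx hy).2 h
      · intro h
        obtain ⟨u, hx⟩ := hd x
        obtain ⟨v, hy⟩ := hd y
        exact ⟨u, v, (key _ _ _ _ hx hy).1 h, hx, hy⟩
end

section
/- If G∗R = H, R has full domain, and R does not satisfy the Hall condition, then there exist a finite set C with |C| < |V_G| and relations R₁ ⊆ V_G×C (with full domain and image all of C) and R₂ ⊆ C×V_H such that R = R₁∘R₂ and (G∗R₁)∗R₂ = H; in particular the graph G' = G∗R₁ has strictly fewer vertices than G. -/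
/-- If `G ∗ R = H`, `R` has full domain and `R` violates the Hall condition, then
`R` factors as `R₁ ∘ R₂` through a vertex set `C` with `|C| < |V_G|`, with
`(G ∗ R₁) ∗ R₂ = H`. -/
theorem stmt13 {V W : Type*} [Fintype V] [Fintype W]
    (E : V → V → Prop) (hE : Symmetric E)
    (F : W → W → Prop) (hF : Symmetric F)
    (R : V → W → Prop)
    (hdom : ∀ x : V, ∃ b : W, R x b)
    (himg : ∀ b : W, ∃ v : V, R v b)
    (hstar : ∀ u v : W, srel E R u v ↔ F u v)
    (hnotHall : ∃ S : Set V, {y : W | ∃ x ∈ S, R x y}.ncard < S.ncard) :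
    ∃ (C : Type) (_ : Fintype C) (R₁ : V → C → Prop) (R₂ : C → W → Prop),
      Nat.card C < Nat.card V ∧
      (∀ x : V, ∃ c : C, R₁ x c) ∧
      (∀ c : C, ∃ x : V, R₁ x c) ∧
      (∀ (x : V) (y : W), R x y ↔ ∃ c, R₁ x c ∧ R₂ c y) ∧
      (∀ u v : W, srel (srel E R₁) R₂ u v ↔ F u v) := by
  classical
  obtain ⟨S, hS⟩ := hnotHall
  let N : Set W := {y : W | ∃ x ∈ S, R x y}
  let D := N ⊕ (Sᶜ : Set V)
  let Q₁ : V → D → Prop := fun x d =>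
    Sum.elim (fun y : N => x ∈ S ∧ R x y.1) (fun z : (Sᶜ : Set V) => z.1 = x) d
  let Q₂ : D → W → Prop := fun d w =>
    Sum.elim (fun y : N => y.1 = w) (fun z : (Sᶜ : Set V) => R z.1 w) d
  let e : D ≃ Fin (Nat.card D) := Finite.equivFin D
  have hcomp : ∀ x y, R x y ↔ ∃ c, Q₁ x (e.symm c) ∧ Q₂ (e.symm c) y := by
    intro x y
    constructor
    · intro h
      by_cases hx : x ∈ S
      · refine ⟨e (Sum.inl ⟨y, x, hx, h⟩), ?_⟩
        rw [e.symm_apply_apply]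
        exact ⟨⟨hx, h⟩, rfl⟩
      · refine ⟨e (Sum.inr ⟨x, hx⟩), ?_⟩
        rw [e.symm_apply_apply]
        exact ⟨rfl, h⟩
    · rintro ⟨c, h1, h2⟩
      generalize e.symm c = d at h1 h2
      rcases d with d | d
      · have h3 : d.1 = y := h2
        exact h3 ▸ h1.2
      · have h3 : d.1 = x := h1
        exact h3 ▸ h2
  refine ⟨Fin (Nat.card D), inferInstance, fun x c => Q₁ x (e.symm c),
    fun c w => Q₂ (e.symm c) w, ?_, ?_, ?_, hcomp, ?_⟩
  · have h1 : Nat.card D = N.ncard + (Sᶜ).ncard := by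
      rw [Nat.card_sum, Nat.card_coe_set_eq, Nat.card_coe_set_eq]
    have h2 := Set.ncard_add_ncard_compl S
    have h3 : N.ncard < S.ncard := hS
    rw [Nat.card_fin]
    omega
  · intro x
    obtain ⟨b, hb⟩ := hdom x
    obtain ⟨c, hc, _⟩ := (hcomp x b).1 hb
    exact ⟨c, hc⟩
  · intro c
    show ∃ x, Q₁ x (e.symm c)
    generalize e.symm c = d
    rcases d with ⟨y, x, hx, h⟩ | d
    · exact ⟨x, hx, h⟩
    · exact ⟨d.1, rfl⟩
  · intro u v
    rw [← hstar]
    constructor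
    · rintro ⟨c, d, ⟨x, y, hxy, hc, hd⟩, hu, hv⟩
      exact ⟨x, y, hxy, (hcomp _ _).2 ⟨c, hc, hu⟩, (hcomp _ _).2 ⟨d, hd, hv⟩⟩
    · rintro ⟨x, y, hxy, hu, hv⟩
      obtain ⟨c, hc, hu⟩ := (hcomp _ _).1 hu
      obtain ⟨d, hd, hv⟩ := (hcomp _ _).1 hv
      exact ⟨c, d, ⟨x, y, hxy, hc, hd⟩, hu, hv⟩
end

section
/- If the graph G is an R-core, then every relation R ⊆ V_G×V_G with full domain and full image satisfying G∗R = G satisfies the Hall condition, and consequently R contains a monomorphism of G into itself. -/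
/-- Weak relational equivalence of the graphs `(V,E)` and `(W,F)`: there are
relations `R ⊆ V×W` and `S ⊆ W×V`, each with full domain and full image, with
`G ∗ R = H` and `H ∗ S = G`. -/
def weakEquiv {V W : Type*} (E : V → V → Prop) (F : W → W → Prop) : Prop :=
  ∃ (R : V → W → Prop) (S : W → V → Prop),
    (∀ x, ∃ b, R x b) ∧ (∀ b, ∃ x, R x b) ∧
    (∀ b, ∃ x, S b x) ∧ (∀ x, ∃ b, S b x) ∧
    (∀ u v, srel E R u v ↔ F u v) ∧
    (∀ x y, srel F S x y ↔ E x y)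

/-- If `G` is an R-core (no graph on fewer vertices is weakly relationally
equivalent to it), then every relation `R` with full domain and image satisfying
`G ∗ R = G` satisfies the Hall condition, and consequently contains a monomorphism
of `G` into itself. -/
theorem stmt14 {V : Type} [Fintype V] (E : V → V → Prop) (hE : Symmetric E)
    (hcore : ∀ (W : Type) (_ : Fintype W) (F : W → W → Prop), Symmetric F →
      Nat.card W < Nat.card V → ¬ weakEquiv F E)
    (R : V → V → Prop)
    (hdom : ∀ x : V, ∃ y : V, R x y)
    (himg : ∀ y : V, ∃ x : V, R x y)
    (hstar : ∀ u v : V, srel E R u v ↔ E u v) :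
    (∀ S : Set V, S.ncard ≤ {y : V | ∃ x ∈ S, R x y}.ncard) ∧
    ∃ f : V → V, Function.Injective f ∧ (∀ x, R x (f x)) ∧
      ∀ x y, E x y → E (f x) (f y) := by
  classical
  have hall : ∀ S : Set V, S.ncard ≤ {y : V | ∃ x ∈ S, R x y}.ncard := by
    intro S
    by_contra hlt
    push Not at hlt
    let T : Set V := {y : V | ∃ x ∈ S, R x y}
    let A : V → (T ⊕ (Sᶜ : Set V)) → Prop := fun x w =>
      Sum.elim (fun t : T => x ∈ S ∧ R x t.1) (fun c : (Sᶜ : Set V) => x = c.1) w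
    let B : (T ⊕ (Sᶜ : Set V)) → V → Prop := fun w y =>
      Sum.elim (fun t : T => t.1 = y) (fun c : (Sᶜ : Set V) => R c.1 y) w
    have hAB : ∀ x y, R x y ↔ ∃ w, A x w ∧ B w y := by
      intro x y
      constructor
      · intro h
        by_cases hx : x ∈ S
        · exact ⟨Sum.inl ⟨y, x, hx, h⟩, ⟨hx, h⟩, rfl⟩
        · exact ⟨Sum.inr ⟨x, hx⟩, rfl, h⟩
      · rintro ⟨t | c, h1, h2⟩
        · have h2' : t.1 = y := h2
          exact h2' ▸ h1.2
        · have h1' : x = c.1 := h1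
          rw [h1']
          exact h2
    refine hcore (T ⊕ (Sᶜ : Set V)) inferInstance (srel E A) ?_ ?_ ⟨B, A, ?_, ?_, ?_, ?_, ?_, ?_⟩
    · rintro u v ⟨x, y, h, hx, hy⟩
      exact ⟨y, x, hE h, hy, hx⟩
    · rw [Nat.card_sum, Nat.card_coe_set_eq, Nat.card_coe_set_eq, ← Set.ncard_add_ncard_compl S]
      exact Nat.add_lt_add_right hlt _
    · rintro (t | c)
      · exact ⟨t.1, rfl⟩
      · exact hdom c.1
    · intro y
      obtain ⟨x, hx⟩ := himg y
      obtain ⟨w, _, h⟩ := (hAB x y).1 hx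
      exact ⟨w, h⟩
    · intro x
      obtain ⟨y, hy⟩ := hdom x
      obtain ⟨w, h, _⟩ := (hAB x y).1 hy
      exact ⟨w, h⟩
    · rintro (⟨y, x, hx, h⟩ | c)
      · exact ⟨x, hx, h⟩
      · exact ⟨c.1, rfl⟩
    · intro u v
      rw [← hstar]
      constructor
      · rintro ⟨a, b, ⟨x, y, h, hx, hy⟩, ha, hb⟩
        exact ⟨x, y, h, (hAB _ _).2 ⟨a, hx, ha⟩, (hAB _ _).2 ⟨b, hy, hb⟩⟩
      · rintro ⟨x, y, h, hx, hy⟩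
        obtain ⟨a, ha, ha'⟩ := (hAB _ _).1 hx
        obtain ⟨b, hb, hb'⟩ := (hAB _ _).1 hy
        exact ⟨a, b, ⟨x, y, h, ha, hb⟩, ha', hb'⟩
    · intro x y
      exact Iff.rfl
  refine ⟨hall, ?_⟩
  obtain ⟨f, hf, hR⟩ := (Finset.all_card_le_biUnion_card_iff_exists_injective
    (fun x : V => Finset.univ.filter (fun y => R x y))).1 (by
      intro s
      have h := hall (s : Set V)
      rw [Set.ncard_coe_finset] at h
      refine h.trans (le_of_eq ?_)
      rw [← Set.ncard_coe_finset]
      congr 1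
      ext y
      simp)
  have hR' : ∀ x, R x (f x) := fun x => by simpa using hR x
  exact ⟨f, hf, hR', fun x y h => (hstar _ _).1 ⟨x, y, h, hR' x, hR' y⟩⟩
end

section
/- If G and H are both R-cores and are weakly relationally equivalent, then G and H are isomorphic graphs. -/
theorem weak_aux_inj {V W : Type} [Fintype V] [Fintype W]
    (E : V → V → Prop) (hE : Symmetric E) (F : W → W → Prop)
    (hcore : ∀ (U : Type) (_ : Fintype U) (D : U → U → Prop), Symmetric D →
      Nat.card U < Nat.card W → ¬ weakEquiv D F)
    (hcard : Nat.card V ≤ Nat.card W)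
    (R : V → W → Prop) (S : W → V → Prop)
    (h1 : ∀ x, ∃ b, R x b) (h2 : ∀ b, ∃ x, R x b)
    (h3 : ∀ b, ∃ x, S b x) (h4 : ∀ x, ∃ b, S b x)
    (h5 : ∀ u v, srel E R u v ↔ F u v)
    (h6 : ∀ x y, srel F S x y ↔ E x y) :
    ∃ f : V → W, Function.Injective f ∧ ∀ x, R x (f x) := by
  classical
  rw [← Fintype.all_card_le_filter_rel_iff_exists_injective]
  intro A
  by_contra hlt
  push Not at hlt
  let B : Finset W := {b : W | ∃ a ∈ A, R a b}
  have hB : ∀ b, b ∈ B ↔ ∃ a ∈ A, R a b := by intro b; simp [B]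
  have hBlt : B.card < A.card := hlt
  -- the factorisation `R = P Q` through the smaller set
  let U := {x : V // x ∉ A} ⊕ {b : W // b ∈ B}
  let P : V → U → Prop := fun x u => match u with
    | Sum.inl y => x = y.1
    | Sum.inr b => x ∈ A ∧ R x b.1
  let Q : U → W → Prop := fun u w => match u with
    | Sum.inl y => R y.1 w
    | Sum.inr b => b.1 = w
  have hPQ : ∀ x w, R x w ↔ ∃ u, P x u ∧ Q u w := by
    intro x w
    constructor
    · intro h
      by_cases hx : x ∈ A
      · exact ⟨Sum.inr ⟨w, (hB w).2 ⟨x, hx, h⟩⟩, ⟨hx, h⟩, rfl⟩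
      · exact ⟨Sum.inl ⟨x, hx⟩, rfl, h⟩
    · rintro ⟨u | u, hp, hq⟩
      · have hp' : x = u.1 := hp
        rw [hp']; exact hq
      · have hq' : u.1 = w := hq
        rw [← hq']; exact hp.2
  have hPdom : ∀ x, ∃ u, P x u := fun x => by
    obtain ⟨b, hb⟩ := h1 x
    obtain ⟨u, hu, _⟩ := (hPQ x b).1 hb
    exact ⟨u, hu⟩
  have hPim : ∀ u, ∃ x, P x u := by
    rintro (u | u)
    · exact ⟨u.1, rfl⟩
    · obtain ⟨a, ha, hr⟩ := (hB u.1).1 u.2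
      exact ⟨a, ha, hr⟩
  have hQdom : ∀ u, ∃ w, Q u w := by
    rintro (u | u)
    · exact h1 u.1
    · exact ⟨u.1, rfl⟩
  have hQim : ∀ w, ∃ u, Q u w := fun w => by
    obtain ⟨x, hx⟩ := h2 w
    obtain ⟨u, _, hu⟩ := (hPQ x w).1 hx
    exact ⟨u, hu⟩
  refine hcore U inferInstance (srel E P) ?_ ?_ ⟨Q, fun w u => ∃ x, S w x ∧ P x u,
    hQdom, hQim, ?_, ?_, ?_, ?_⟩
  · rintro u v ⟨x, y, h, hx, hy⟩
    exact ⟨y, x, hE h, hy, hx⟩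
  · refine lt_of_lt_of_le ?_ hcard
    have hc : Fintype.card {x : V // x ∉ A} = Fintype.card V - A.card := by
      rw [Fintype.card_subtype_compl]; simp
    have hA := Finset.card_le_univ A
    rw [Nat.card_eq_fintype_card, Nat.card_eq_fintype_card, Fintype.card_sum, hc,
      Fintype.card_coe]
    omega
  · intro b
    obtain ⟨x, hx⟩ := h3 b
    obtain ⟨u, hu⟩ := hPdom x
    exact ⟨u, x, hx, hu⟩
  · intro u
    obtain ⟨x, hx⟩ := hPim u
    obtain ⟨b, hb⟩ := h4 x
    exact ⟨b, x, hb, hx⟩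
  · intro u v
    rw [← h5]
    constructor
    · rintro ⟨a, b, ⟨x, y, h, hx, hy⟩, ha, hb⟩
      exact ⟨x, y, h, (hPQ _ _).2 ⟨a, hx, ha⟩, (hPQ _ _).2 ⟨b, hy, hb⟩⟩
    · rintro ⟨x, y, h, hx, hy⟩
      obtain ⟨a, ha, ha'⟩ := (hPQ _ _).1 hx
      obtain ⟨b, hb, hb'⟩ := (hPQ _ _).1 hy
      exact ⟨a, b, ⟨x, y, h, ha, hb⟩, ha', hb'⟩
  · intro u v
    constructor
    · rintro ⟨a, b, h, ⟨x, hax, hx⟩, ⟨y, hby, hy⟩⟩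
      exact ⟨x, y, (h6 x y).1 ⟨a, b, h, hax, hby⟩, hx, hy⟩
    · rintro ⟨x, y, h, hx, hy⟩
      obtain ⟨a, b, hf, ha, hb⟩ := (h6 x y).2 h
      exact ⟨a, b, hf, ⟨x, ha, hx⟩, ⟨y, hb, hy⟩⟩

/-- If `G` and `H` are both R-cores and are weakly relationally equivalent, then
they are isomorphic graphs. -/
theorem stmt15 {V W : Type} [Fintype V] [Fintype W]
    (E : V → V → Prop) (hE : Symmetric E)
    (F : W → W → Prop) (hF : Symmetric F)
    (hGcore : ∀ (U : Type) (_ : Fintype U) (D : U → U → Prop), Symmetric D →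
      Nat.card U < Nat.card V → ¬ weakEquiv D E)
    (hHcore : ∀ (U : Type) (_ : Fintype U) (D : U → U → Prop), Symmetric D →
      Nat.card U < Nat.card W → ¬ weakEquiv D F)
    (hGH : weakEquiv E F) :
    ∃ φ : V ≃ W, ∀ x y : V, E x y ↔ F (φ x) (φ y) := by
  have hc1 : Nat.card W ≤ Nat.card V := by
    by_contra h
    exact hHcore V inferInstance E hE (not_le.1 h) hGH
  obtain ⟨R, S, h1, h2, h3, h4, h5, h6⟩ := hGH
  have hc2 : Nat.card V ≤ Nat.card W := by
    by_contra h
    exact hGcore W inferInstance F hF (not_le.1 h) ⟨S, R, h3, h4, h1, h2, h6, h5⟩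
  obtain ⟨f, hf, hfR⟩ := weak_aux_inj E hE F hHcore hc2 R S h1 h2 h3 h4 h5 h6
  obtain ⟨g, hg, hgS⟩ := weak_aux_inj F hF E hGcore hc1 S R h3 h4 h1 h2 h6 h5
  have hEF : ∀ x y, E x y → F (f x) (f y) := fun x y h => (h5 _ _).1 ⟨x, y, h, hfR x, hfR y⟩
  have hFE : ∀ x y, F x y → E (g x) (g y) := fun x y h => (h6 _ _).1 ⟨x, y, h, hgS x, hgS y⟩
  let e1 : {p : V × V // E p.1 p.2} → {p : W × W // F p.1 p.2} :=
    fun p => ⟨(f p.1.1, f p.1.2), hEF _ _ p.2⟩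
  let e2 : {p : W × W // F p.1 p.2} → {p : V × V // E p.1 p.2} :=
    fun p => ⟨(g p.1.1, g p.1.2), hFE _ _ p.2⟩
  have he1 : Function.Injective e1 := by
    rintro ⟨⟨a, b⟩, hp⟩ ⟨⟨c, d⟩, hq⟩ h
    simp only [e1, Subtype.mk.injEq, Prod.mk.injEq] at h ⊢
    exact ⟨hf h.1, hf h.2⟩
  have he2 : Function.Injective e2 := by
    rintro ⟨⟨a, b⟩, hp⟩ ⟨⟨c, d⟩, hq⟩ h
    simp only [e2, Subtype.mk.injEq, Prod.mk.injEq] at h ⊢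
    exact ⟨hg h.1, hg h.2⟩
  have hbij := he1.bijective_of_nat_card_le (Nat.card_le_card_of_injective e2 he2)
  refine ⟨Equiv.ofBijective f (hf.bijective_of_nat_card_le hc1), fun x y => ⟨hEF x y, ?_⟩⟩
  intro h
  obtain ⟨⟨⟨a, b⟩, hab⟩, hp⟩ := hbij.2 ⟨(f x, f y), h⟩
  have hp := Prod.mk.inj (congrArg Subtype.val hp)
  rw [← hf hp.1, ← hf hp.2]
  exact hab
end

section
/- If H is an R-core that is weakly relationally equivalent to the graph G, then H is isomorphic to an induced subgraph of G; that is, there is an injective map I : V_H → V_G such that (x,y) ∈ E_H if and only if (I(x),I(y)) ∈ E_G. -/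
lemma aux_twin {W : Type} [Fintype W] (F : W → W → Prop) (hF : Symmetric F)
    (hcore : ∀ (U : Type) (_ : Fintype U) (D : U → U → Prop), Symmetric D →
      Nat.card U < Nat.card W → ¬ weakEquiv D F)
    (a b : W) (h : ∀ y, F a y ↔ F b y) : a = b := by
  classical
  by_contra hab
  have h' : ∀ y, F y a ↔ F y b := fun y =>
    ⟨fun k => hF ((h y).1 (hF k)), fun k => hF ((h y).2 (hF k))⟩
  let r : W → W := fun x => if x = b then a else x
  have hr : ∀ x, r x ≠ b := by
    intro x
    by_cases hx : x = b <;> simp [r, hx, hab]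
  have hrF : ∀ x y, F (r x) (r y) ↔ F x y := by
    intro x y
    by_cases hx : x = b <;> by_cases hy : y = b <;> simp [r, hx, hy, h, h']
  have hrr : ∀ x, x ≠ b → r x = x := fun x hx => by simp [r, hx]
  refine hcore {x : W // x ≠ b} inferInstance (fun x y => F x.1 y.1)
    (fun x y k => hF k) ?_ ?_
  · rw [Nat.card_eq_fintype_card, Nat.card_eq_fintype_card]
    exact Fintype.card_subtype_lt (x := b) (by simp)
  · refine ⟨fun u w => r w = u.1, fun w u => r w = u.1, ?_, ?_, ?_, ?_, ?_, ?_⟩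
    · exact fun x => ⟨x.1, hrr _ x.2⟩
    · exact fun w => ⟨⟨r w, hr w⟩, rfl⟩
    · exact fun w => ⟨⟨r w, hr w⟩, rfl⟩
    · exact fun x => ⟨x.1, hrr _ x.2⟩
    · intro u v
      constructor
      · rintro ⟨x, y, hxy, hx, hy⟩
        rw [← hrF, hx, hy]; exact hxy
      · intro k
        exact ⟨⟨r u, hr u⟩, ⟨r v, hr v⟩, (hrF _ _).2 k, rfl, rfl⟩
    · intro u v
      constructor
      · rintro ⟨x, y, hxy, hx, hy⟩
        rw [← hx, ← hy, hrF]; exact hxy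
      · intro k
        exact ⟨u.1, v.1, k, hrr _ u.2, hrr _ v.2⟩

lemma aux_hall {W : Type} [Fintype W] (F : W → W → Prop) (hF : Symmetric F)
    (hcore : ∀ (U : Type) (_ : Fintype U) (D : U → U → Prop), Symmetric D →
      Nat.card U < Nat.card W → ¬ weakEquiv D F)
    (T : W → W → Prop) (hd : ∀ x, ∃ y, T x y) (hi : ∀ y, ∃ x, T x y)
    (hT : ∀ u v, srel F T u v ↔ F u v) :
    ∃ p : W → W, Function.Injective p ∧ ∀ x, T x (p x) := by
  classical
  rw [← Fintype.all_card_le_filter_rel_iff_exists_injective]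
  by_contra hn
  push Not at hn
  obtain ⟨A, hA⟩ := hn
  let B : Finset W := {b | ∃ a ∈ A, T a b}
  have hAB : B.card < A.card := hA
  have hB : ∀ y, y ∈ B ↔ ∃ a ∈ A, T a y := by simp [B]
  let P : W → {x // x ∈ Aᶜ} ⊕ {y // y ∈ B} → Prop :=
    fun w u => Sum.elim (fun a => w = a.1) (fun b => T w b.1) u
  let Q : {x // x ∈ Aᶜ} ⊕ {y // y ∈ B} → W → Prop :=
    fun u w => Sum.elim (fun a => T a.1 w) (fun b => w = b.1) u
  have hPQ : ∀ x y, T x y ↔ ∃ u, P x u ∧ Q u y := by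
    intro x y
    constructor
    · intro h
      by_cases hx : x ∈ A
      · exact ⟨Sum.inr ⟨y, (hB y).2 ⟨x, hx, h⟩⟩, h, rfl⟩
      · exact ⟨Sum.inl ⟨x, by simpa using hx⟩, rfl, h⟩
    · rintro ⟨u | u, h1, h2⟩
      · have h1 : x = u.1 := h1
        rw [h1]; exact h2
      · have h2 : y = u.1 := h2
        rw [h2]; exact h1
  refine hcore _ inferInstance (srel F P) ?_ ?_ ⟨Q, P, ?_, ?_, ?_, ?_, ?_, ?_⟩
  · rintro u v ⟨x, y, h, hx, hy⟩
    exact ⟨y, x, hF h, hy, hx⟩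
  · rw [Nat.card_eq_fintype_card, Nat.card_eq_fintype_card, Fintype.card_sum,
      Fintype.card_coe, Fintype.card_coe, Finset.card_compl]
    have := Finset.card_le_univ A
    omega
  · rintro (u | u)
    · exact hd u.1
    · exact ⟨u.1, rfl⟩
  · intro y
    obtain ⟨x, h⟩ := hi y
    obtain ⟨u, -, h⟩ := (hPQ _ _).1 h
    exact ⟨u, h⟩
  · intro x
    obtain ⟨y, h⟩ := hd x
    obtain ⟨u, h, -⟩ := (hPQ _ _).1 h
    exact ⟨u, h⟩
  · rintro (u | u)
    · exact ⟨u.1, rfl⟩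
    · exact hi u.1
  · intro u v
    rw [← hT]
    constructor
    · rintro ⟨s, t, ⟨x, y, h, hx, hy⟩, hs, ht⟩
      exact ⟨x, y, h, (hPQ _ _).2 ⟨s, hx, hs⟩, (hPQ _ _).2 ⟨t, hy, ht⟩⟩
    · rintro ⟨x, y, h, hx, hy⟩
      obtain ⟨s, hx, hs⟩ := (hPQ _ _).1 hx
      obtain ⟨t, hy, ht⟩ := (hPQ _ _).1 hy
      exact ⟨s, t, ⟨x, y, h, hx, hy⟩, hs, ht⟩
  · exact fun u v => Iff.rfl

/-- If `H` is an R-core weakly relationally equivalent to `G`, then `H` is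
isomorphic to an induced subgraph of `G`. -/
theorem stmt16 {V W : Type} [Fintype V] [Fintype W]
    (E : V → V → Prop) (hE : Symmetric E)
    (F : W → W → Prop) (hF : Symmetric F)
    (hHcore : ∀ (U : Type) (_ : Fintype U) (D : U → U → Prop), Symmetric D →
      Nat.card U < Nat.card W → ¬ weakEquiv D F)
    (hGH : weakEquiv E F) :
    ∃ I : W → V, Function.Injective I ∧
      ∀ x y : W, F x y ↔ E (I x) (I y) := by
  classical
  obtain ⟨R, S, hR1, hR2, hS1, hS2, hR, hS⟩ := hGH
  obtain ⟨p, hp, hpT⟩ := aux_hall F hF hHcore (fun x y => ∃ v, S x v ∧ R v y)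
    (fun x => by
      obtain ⟨v, hv⟩ := hS1 x
      obtain ⟨y, hy⟩ := hR1 v
      exact ⟨y, v, hv, hy⟩)
    (fun y => by
      obtain ⟨v, hv⟩ := hR2 y
      obtain ⟨x, hx⟩ := hS2 v
      exact ⟨x, v, hx, hv⟩)
    (fun u v => by
      rw [← hR]
      constructor
      · rintro ⟨x, y, h, ⟨s, hs, hs'⟩, ⟨t, ht, ht'⟩⟩
        exact ⟨s, t, (hS _ _).1 ⟨x, y, h, hs, ht⟩, hs', ht'⟩
      · rintro ⟨s, t, h, hs, ht⟩
        obtain ⟨x, y, h, hx, hy⟩ := (hS _ _).2 h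
        exact ⟨x, y, h, ⟨s, hx, hs⟩, ⟨t, hy, ht⟩⟩)
  choose I hI1 hI2 using hpT
  have h1 : ∀ x y, F x y → E (I x) (I y) := fun x y h =>
    (hS _ _).1 ⟨x, y, h, hI1 x, hI1 y⟩
  have h2 : ∀ x y, E (I x) (I y) → F (p x) (p y) := fun x y h =>
    (hR _ _).1 ⟨_, _, h, hI2 x, hI2 y⟩
  let f : {e : W × W // F e.1 e.2} → {e : W × W // F e.1 e.2} :=
    fun e => ⟨(p e.1.1, p e.1.2), h2 _ _ (h1 _ _ e.2)⟩
  have hf : Function.Injective f := by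
    rintro ⟨⟨a, b⟩, h⟩ ⟨⟨c, d⟩, h'⟩ k
    simp only [f, Subtype.mk.injEq, Prod.mk.injEq] at k
    simp [hp k.1, hp k.2]
  have hfs : Function.Surjective f := Finite.injective_iff_surjective.1 hf
  have h3 : ∀ x y, F (p x) (p y) → F x y := by
    intro x y h
    obtain ⟨⟨⟨a, b⟩, h'⟩, k⟩ := hfs ⟨(p x, p y), h⟩
    simp only [f, Subtype.mk.injEq, Prod.mk.injEq] at k
    rw [← hp k.1, ← hp k.2]; exact h'
  have h4 : ∀ x y, F x y ↔ E (I x) (I y) := fun x y =>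
    ⟨h1 x y, fun h => h3 _ _ (h2 _ _ h)⟩
  refine ⟨I, fun a b hab => aux_twin F hF hHcore a b (fun y => ?_), h4⟩
  rw [h4, h4, hab]
end

section
/- For a graph G, every relation R ⊆ V_G×V_G with image all of V_G satisfying G∗R = G is the graph {(x,f(x)) : x ∈ V_G} of an automorphism f of G, if and only if G satisfies condition N: N_G(x) ⊆ N_G(y) implies x = y for all x,y ∈ V_G. -/
/-- Iterated relational composition. -/
def relPow {V : Type*} (R : V → V → Prop) : ℕ → V → V → Prop
  | 0 => fun x y => x = y
  | n + 1 => fun x z => ∃ y, R x y ∧ relPow R n y z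

lemma relPow_add {V : Type*} (R : V → V → Prop) (n m : ℕ) (x z : V) :
    relPow R (n + m) x z ↔ ∃ y, relPow R n x y ∧ relPow R m y z := by
  induction n generalizing x with
  | zero => simp [relPow]
  | succ n ih =>
    rw [Nat.succ_add]
    simp only [relPow, ih]
    constructor
    · rintro ⟨a, h1, b, h2, h3⟩
      exact ⟨b, ⟨a, h1, h2⟩, h3⟩
    · rintro ⟨b, ⟨a, h1, h2⟩, h3⟩
      exact ⟨a, h1, b, h2, h3⟩

lemma relPow_one {V : Type*} (R : V → V → Prop) (x y : V) : relPow R 1 x y ↔ R x y := by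
  simp [relPow]

lemma relPow_surj {V : Type*} (R : V → V → Prop) (h : ∀ y : V, ∃ x : V, R x y) (n : ℕ) (y : V) :
    ∃ x, relPow R n x y := by
  induction n with
  | zero => exact ⟨y, rfl⟩
  | succ n ih =>
    obtain ⟨x, hx⟩ := ih
    obtain ⟨w, hw⟩ := h x
    exact ⟨w, x, hw, hx⟩

lemma relPow_srel {V : Type*} (E R : V → V → Prop) (h : ∀ u v : V, srel E R u v ↔ E u v)
    (n : ℕ) (u v : V) : srel E (relPow R n) u v ↔ E u v := by
  induction n generalizing u v with
  | zero => simp [srel, relPow]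
  | succ n ih =>
    rw [← ih]
    constructor
    · rintro ⟨x, y, e, ⟨a, ha, ha'⟩, b, hb, hb'⟩
      exact ⟨a, b, (h a b).1 ⟨x, y, e, ha, hb⟩, ha', hb'⟩
    · rintro ⟨a, b, e, ha', hb'⟩
      obtain ⟨x, y, e, ha, hb⟩ := (h a b).2 e
      exact ⟨x, y, e, ⟨a, ha, ha'⟩, b, hb, hb'⟩

/-- Every relation `R ⊆ V_G × V_G` with image all of `V_G` satisfying `G ∗ R = G`
is the graph of an automorphism of `G`, iff `G` satisfies condition N:
`N_G(x) ⊆ N_G(y)` implies `x = y`. -/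
theorem stmt17 {V : Type*} [Fintype V] (E : V → V → Prop) (hE : Symmetric E) :
    (∀ R : V → V → Prop, (∀ y : V, ∃ x : V, R x y) →
      (∀ u v : V, srel E R u v ↔ E u v) →
      ∃ f : V → V, Function.Bijective f ∧
        (∀ x y : V, R x y ↔ f x = y) ∧
        (∀ x y : V, E x y ↔ E (f x) (f y))) ↔
      (∀ x y : V, (∀ z, E x z → E y z) → x = y) := by
  constructor
  · intro H x y hxy
    obtain ⟨f, -, hf, -⟩ := H (fun a b => a = b ∨ (a = x ∧ b = y)) (fun b => ⟨b, Or.inl rfl⟩) (by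
      intro u v
      constructor
      · rintro ⟨a, b, e, rfl | ⟨rfl, rfl⟩, rfl | ⟨rfl, rfl⟩⟩
        · exact e
        · exact hE (hxy _ (hE e))
        · exact hxy _ e
        · exact hxy _ (hE (hxy _ e))
      · intro e
        exact ⟨u, v, e, Or.inl rfl, Or.inl rfl⟩)
    have h1 := (hf x x).1 (Or.inl rfl)
    have h2 := (hf x y).1 (Or.inr ⟨rfl, rfl⟩)
    exact h1.symm.trans h2
  · intro N R hR hG
    obtain ⟨m, k, hlt, hmk⟩ : ∃ m k, m < k ∧ relPow R m = relPow R k := by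
      obtain ⟨a, b, hab, h⟩ := Finite.exists_ne_map_eq_of_infinite (relPow R)
      rcases lt_or_gt_of_ne hab with h' | h'
      · exact ⟨a, b, h', h⟩
      · exact ⟨b, a, h', h.symm⟩
    obtain ⟨d, rfl⟩ := Nat.exists_eq_add_of_lt hlt
    have hsub : ∀ w v, relPow R (d + 1) w v → w = v := by
      intro w v hwv
      apply N
      intro u e
      obtain ⟨x, y, e', hx, hy⟩ := (relPow_srel E R hG m w u).2 e
      apply (relPow_srel E R hG m v u).1
      refine ⟨x, y, e', ?_, hy⟩
      rw [hmk, add_assoc, relPow_add]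
      exact ⟨w, hx, hwv⟩
    have hid : ∀ v, relPow R (d + 1) v v := by
      intro v
      obtain ⟨w, hw⟩ := relPow_surj R hR (d + 1) v
      have := hsub w v hw
      subst this
      exact hw
    choose f hf hfS using hid
    have huniq : ∀ x y, R x y ↔ f x = y := by
      intro x y
      constructor
      · intro hxy
        exact hsub _ _ ((relPow_add R d 1 _ _).2 ⟨x, hfS x, (relPow_one R x y).2 hxy⟩)
      · rintro rfl
        exact hf x
    have hsurj : Function.Surjective f := fun y => by
      obtain ⟨x, hx⟩ := hR y
      exact ⟨x, (huniq x y).1 hx⟩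
    have hinj : Function.Injective f := Finite.injective_iff_surjective.2 hsurj
    refine ⟨f, ⟨hinj, hsurj⟩, huniq, fun x y => ⟨fun e => (hG _ _).1 ⟨x, y, e, hf x, hf y⟩, ?_⟩⟩
    intro e
    obtain ⟨a, b, e', ha, hb⟩ := (hG _ _).2 e
    rw [← hinj ((huniq _ _).1 ha), ← hinj ((huniq _ _).1 hb)]
    exact e'
end
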